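/- Let v_F > 0, ε > 0, δ₊, δ₋ > 1, and k, ω ∈ ℝ, and set Ω_± = (ω ± v_F k)/(2 v_F). Then the double integral ∫_ℝ ∫_ℝ e^{i(ωt − kx)} · (i[v_F(t−iε) − x])^{−δ₊} · (i[v_F(t−iε) + x])^{−δ₋} dt dx converges absolutely and equals ((2π)² e^{−εω})/(2 v_F Γ(δ₊)Γ(δ₋)) · Ω₊^{δ₊−1} Ω₋^{δ₋−1} if both Ω₊ > 0 and Ω₋ > 0, and equals 0 otherwise. -/

import Mathlib

open MeasureTheory Real

/-- The integrand `e^{i(ωt − kx)} (i[v_F(t−iε) − x])^{−δ₊} (i[v_F(t−iε) + x])^{−δ₋}` of the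
continuous factorized Fourier transform. -/
noncomputable def contIntegrand (vF ε δp δm k ω : ℝ) (x t : ℝ) : ℂ :=
  Complex.exp (Complex.I * ((ω : ℂ) * (t : ℂ) - (k : ℂ) * (x : ℂ))) *
    (Complex.I * ((vF : ℂ) * ((t : ℂ) - Complex.I * (ε : ℂ)) - (x : ℂ))) ^ (-(δp : ℂ)) *
    (Complex.I * ((vF : ℂ) * ((t : ℂ) - Complex.I * (ε : ℂ)) + (x : ℂ))) ^ (-(δm : ℂ))

theorem integrableOn_cpow_mul_exp_neg_mul_Ioi {a r : ℂ} (ha : 0 < a.re) (hr : 0 < r.re) :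
    IntegrableOn (fun t : ℝ => (t : ℂ) ^ (a - 1) * Complex.exp (-(r * t))) (Set.Ioi 0) := by
  have hmeas : AEStronglyMeasurable (fun t : ℝ => (t : ℂ) ^ (a - 1) * Complex.exp (-(r * t)))
      (volume.restrict (Set.Ioi 0)) := by
    refine ContinuousOn.aestronglyMeasurable (.mul (fun t ht => ?_) (by fun_prop))
      measurableSet_Ioi
    exact ((continuousAt_cpow_const (Or.inl (by simpa using ht))).comp
      Complex.continuous_ofReal.continuousAt).continuousWithinAt
  refine (integrable_norm_iff hmeas).mp (IntegrableOn.congr_fun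
    (integrableOn_rpow_mul_exp_neg_mul_rpow (s := a.re - 1) (by linarith) one_pos hr)
    (fun t ht => ?_) measurableSet_Ioi)
  simp [Complex.norm_cpow_eq_rpow_re_of_pos ht, Complex.norm_exp]

theorem differentiableAt_integral_cpow_mul_exp_neg_mul_Ioi {a r : ℂ} (ha : 0 < a.re)
    (hr : 0 < r.re) :
    DifferentiableAt ℂ (fun r : ℂ =>
      ∫ t : ℝ in Set.Ioi 0, (t : ℂ) ^ (a - 1) * Complex.exp (-(r * t))) r := by
  have hball : ∀ z ∈ Metric.ball r (r.re / 2), r.re / 2 < z.re := fun z hz => by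
    have h1 := (Complex.abs_re_le_norm (z - r)).trans_lt (mem_ball_iff_norm.mp hz)
    rw [Complex.sub_re] at h1
    linarith [(abs_lt.mp h1).1]
  have hmeas : ∀ z : ℂ, 0 < z.re → AEStronglyMeasurable
      (fun t : ℝ => (t : ℂ) ^ (a - 1) * Complex.exp (-(z * t)))
      (volume.restrict (Set.Ioi 0)) := fun z hz =>
    (integrableOn_cpow_mul_exp_neg_mul_Ioi ha hz).aestronglyMeasurable
  refine (hasDerivAt_integral_of_dominated_loc_of_deriv_le
    (F := fun (z : ℂ) (t : ℝ) => (t : ℂ) ^ (a - 1) * Complex.exp (-(z * t)))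
    (F' := fun (z : ℂ) (t : ℝ) => (t : ℂ) ^ (a - 1) * Complex.exp (-(z * t)) * -t)
    (bound := fun t : ℝ => t ^ a.re * Real.exp (-(r.re / 2) * t ^ (1 : ℝ)))
    (Metric.ball_mem_nhds r (half_pos hr)) ?_ (integrableOn_cpow_mul_exp_neg_mul_Ioi ha hr)
    ((hmeas r hr).mul (Continuous.aestronglyMeasurable (by fun_prop))) ?_
    (integrableOn_rpow_mul_exp_neg_mul_rpow (by linarith) one_pos (half_pos hr)) ?_).2.differentiableAt
  · filter_upwards [Metric.ball_mem_nhds r (half_pos hr)] with z hz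
    exact hmeas z ((half_pos hr).trans (hball z hz))
  · refine (ae_restrict_iff' measurableSet_Ioi).mpr (.of_forall fun t ht z hz => ?_)
    have ht0 : 0 < t := ht
    rw [norm_mul, norm_mul, Complex.norm_cpow_eq_rpow_re_of_pos ht0, Complex.norm_exp, norm_neg,
      Complex.norm_of_nonneg ht0.le, mul_right_comm, Complex.sub_re, Complex.one_re,
      ← rpow_add_one ht0.ne', sub_add_cancel, rpow_one]
    have := hball z hz
    simp only [Complex.neg_re, Complex.re_mul_ofReal]
    gcongr
    nlinarith
  · refine .of_forall fun t z _ => ?_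
    have h := (((hasDerivAt_id z).mul_const (t : ℂ)).fun_neg.cexp).const_mul ((t : ℂ) ^ (a - 1))
    simpa [mul_assoc] using h

theorem integral_cpow_mul_exp_neg_complex_mul_Ioi {a r : ℂ} (ha : 0 < a.re) (hr : 0 < r.re) :
    ∫ t : ℝ in Set.Ioi 0, (t : ℂ) ^ (a - 1) * Complex.exp (-(r * t)) =
      Complex.Gamma a * r ^ (-a) := by
  have hopen : IsOpen {z : ℂ | 0 < z.re} := isOpen_lt continuous_const Complex.continuous_re
  have hf : AnalyticOnNhd ℂ (fun r : ℂ =>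
      ∫ t : ℝ in Set.Ioi 0, (t : ℂ) ^ (a - 1) * Complex.exp (-(r * t))) {z : ℂ | 0 < z.re} :=
    DifferentiableOn.analyticOnNhd (fun z hz =>
      (differentiableAt_integral_cpow_mul_exp_neg_mul_Ioi ha hz).differentiableWithinAt) hopen
  have hg : AnalyticOnNhd ℂ (fun r : ℂ => Complex.Gamma a * r ^ (-a)) {z : ℂ | 0 < z.re} :=
    DifferentiableOn.analyticOnNhd (fun z hz =>
      ((differentiableAt_id.cpow_const (Or.inl hz)).const_mul _).differentiableWithinAt) hopen
  refine hf.eqOn_of_preconnected_of_frequently_eq hg (convex_halfSpace_re_gt 0).isPreconnected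
    (z₀ := ((1 : ℝ) : ℂ)) (by simp) ?_ hr
  have ht : Filter.Tendsto ((↑) : ℝ → ℂ) (nhdsWithin 1 (Set.Ioi 1))
      (nhdsWithin ((1 : ℝ) : ℂ) {((1 : ℝ) : ℂ)}ᶜ) :=
    tendsto_nhdsWithin_of_tendsto_nhds_of_eventually_within _
      (Complex.continuous_ofReal.continuousAt.mono_left nhdsWithin_le_nhds)
      (by filter_upwards [self_mem_nhdsWithin] with x hx
          exact fun h => (ne_of_gt hx) (Complex.ofReal_injective h))
  refine ht.frequently (Filter.Eventually.frequently ?_)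
  filter_upwards [self_mem_nhdsWithin] with x hx
  have hx0 : 0 < x := one_pos.trans hx
  rw [Complex.integral_cpow_mul_exp_neg_mul_Ioi ha hx0, one_div, Complex.inv_cpow _ _
    (by rw [Complex.arg_ofReal_of_nonneg hx0.le]; exact pi_ne_zero.symm), ← Complex.cpow_neg,
    mul_comm]

theorem norm_re_add_mul_I_cpow {c : ℝ} (hc : 0 < c) (δ a : ℝ) :
    ‖((c : ℂ) + Complex.I * a) ^ (-(δ : ℂ))‖ = c ^ (-δ) * (1 + ‖a / c‖ ^ 2) ^ (-δ / 2) := by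
  rw [← Complex.ofReal_neg, Complex.norm_cpow_real, mul_comm Complex.I, Complex.norm_add_mul_I,
    sqrt_eq_rpow, ← rpow_mul (by positivity),
    show c ^ 2 + a ^ 2 = c ^ 2 * (1 + ‖a / c‖ ^ 2) by
      rw [Real.norm_eq_abs, sq_abs]; field_simp,
    mul_rpow (by positivity) (by positivity), ← rpow_natCast c 2, ← rpow_mul hc.le]
  congr 2 <;> ring_nf

theorem continuous_re_add_mul_I_cpow {c : ℝ} (hc : 0 < c) (s : ℂ) :
    Continuous fun a : ℝ => ((c : ℂ) + Complex.I * a) ^ s :=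
  Continuous.cpow (by fun_prop) continuous_const fun a => Or.inl (by simpa using hc)

theorem integrable_re_add_mul_I_cpow {c δ : ℝ} (hc : 0 < c) (hδ : 1 < δ) :
    Integrable fun a : ℝ => ((c : ℂ) + Complex.I * a) ^ (-(δ : ℂ)) := by
  rw [← integrable_norm_iff (continuous_re_add_mul_I_cpow hc _).aestronglyMeasurable]
  simp_rw [norm_re_add_mul_I_cpow hc]
  have h : Integrable (fun x : ℝ => (1 + ‖x‖ ^ 2) ^ (-δ / 2)) :=
    integrable_rpow_neg_one_add_norm_sq (by simpa using hδ)
  exact (h.comp_div hc.ne').const_mul _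

/-- The unnormalized Gamma density `e^{-cs} s^{δ-1}` on `s > 0`, extended by zero. -/
noncomputable def gammaKernel (c δ s : ℝ) : ℂ :=
  (Real.exp (-(c * s)) * max s 0 ^ (δ - 1) : ℝ)

theorem continuous_gammaKernel {c δ : ℝ} (hδ : 1 < δ) : Continuous (gammaKernel c δ) := by
  unfold gammaKernel
  refine Complex.continuous_ofReal.comp (Continuous.mul (by fun_prop) ?_)
  exact (continuous_id.max continuous_const).rpow_const fun _ => Or.inr (by linarith)

theorem gammaKernel_of_nonpos {c δ s : ℝ} (hδ : 1 < δ) (hs : s ≤ 0) : gammaKernel c δ s = 0 := by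
  simp [gammaKernel, max_eq_right hs, zero_rpow (by linarith : δ - 1 ≠ 0)]

theorem support_gammaKernel_subset {c δ : ℝ} (hδ : 1 < δ) :
    Function.support (gammaKernel c δ) ⊆ Set.Ioi 0 := fun s hs => by
  by_contra h
  exact hs (gammaKernel_of_nonpos hδ (not_lt.mp h))

theorem integrable_gammaKernel {c δ : ℝ} (hc : 0 < c) (hδ : 1 < δ) :
    Integrable (gammaKernel c δ) := by
  rw [← integrableOn_iff_integrable_of_support_subset (support_gammaKernel_subset hδ)]
  refine IntegrableOn.congr_fun (f := fun s : ℝ => ((s ^ (δ - 1) * rexp (-c * s ^ (1 : ℝ)) : ℝ) : ℂ))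
    ?_ (fun s hs => ?_) measurableSet_Ioi
  · exact (integrableOn_rpow_mul_exp_neg_mul_rpow (by linarith) one_pos hc).ofReal
  · simp only [gammaKernel, max_eq_left (Set.mem_Ioi.mp hs).le, rpow_one, neg_mul]
    rw [mul_comm]

theorem fourier_gammaKernel {c δ : ℝ} (hc : 0 < c) (hδ : 1 < δ) (w : ℝ) :
    FourierTransform.fourier (gammaKernel c δ) w =
      Complex.Gamma δ * ((c : ℂ) + Complex.I * (2 * π * w : ℝ)) ^ (-(δ : ℂ)) := by
  rw [fourier_real_eq_integral_exp_smul, ← setIntegral_eq_integral_of_forall_compl_eq_zero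
    (s := Set.Ioi 0) fun s hs => by simp [gammaKernel_of_nonpos hδ (not_lt.mp hs)]]
  have hre : 0 < ((c : ℂ) + Complex.I * (2 * π * w : ℝ)).re := by simpa using hc
  rw [← integral_cpow_mul_exp_neg_complex_mul_Ioi (by simp; linarith) hre]
  refine setIntegral_congr_fun measurableSet_Ioi fun s hs => ?_
  have hs0 : (0 : ℝ) ≤ s := (Set.mem_Ioi.mp hs).le
  simp only [gammaKernel, max_eq_left hs0, smul_eq_mul, Complex.ofReal_mul, Complex.ofReal_exp,
    Complex.ofReal_cpow hs0]
  rw [← mul_assoc, ← Complex.exp_add, mul_comm]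
  push_cast
  congr 2
  ring

theorem integral_exp_mul_re_add_mul_I_cpow {c δ : ℝ} (hc : 0 < c) (hδ : 1 < δ) (Ω : ℝ) :
    ∫ a : ℝ, Complex.exp (Complex.I * (Ω * a)) * ((c : ℂ) + Complex.I * a) ^ (-(δ : ℂ)) =
      2 * π / Complex.Gamma δ * gammaKernel c δ Ω := by
  have hΓ : Complex.Gamma δ ≠ 0 := Complex.Gamma_ne_zero_of_re_pos (by simp; linarith)
  have hint : Integrable (FourierTransform.fourier (gammaKernel c δ)) := by
    rw [funext (fourier_gammaKernel hc hδ)]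
    exact ((integrable_re_add_mul_I_cpow hc hδ).comp_mul_left' two_pi_pos.ne').const_mul _
  have h := congrFun ((continuous_gammaKernel (c := c) hδ).fourierInv_fourier_eq
    (integrable_gammaKernel hc hδ) hint) Ω
  have hcv := Measure.integral_comp_mul_left (fun a : ℝ => Complex.exp (Complex.I * (Ω * a)) *
    ((c : ℂ) + Complex.I * a) ^ (-(δ : ℂ))) (2 * π)
  have hL : ∫ x : ℝ, Complex.exp (↑(2 * π * inner ℝ x Ω) * Complex.I) •
      FourierTransform.fourier (gammaKernel c δ) x = Complex.Gamma δ *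
      ∫ x : ℝ, Complex.exp (Complex.I * (Ω * (2 * π * x : ℝ))) *
        ((c : ℂ) + Complex.I * (2 * π * x : ℝ)) ^ (-(δ : ℂ)) := by
    rw [← integral_const_mul]
    refine integral_congr_ae (.of_forall fun x => ?_)
    simp only [fourier_gammaKernel hc hδ, smul_eq_mul, RCLike.inner_apply]
    rw [mul_left_comm]
    congr 3
    simp
    ring
  rw [Real.fourierInv_eq', hL, hcv, abs_of_pos (inv_pos.mpr two_pi_pos), Complex.real_smul] at h
  rw [← h]
  push_cast
  field_simp

theorem integrable_exp_mul_re_add_mul_I_cpow {c δ : ℝ} (hc : 0 < c) (hδ : 1 < δ) (Ω : ℝ) :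
    Integrable fun a : ℝ =>
      Complex.exp (Complex.I * (Ω * a)) * ((c : ℂ) + Complex.I * a) ^ (-(δ : ℂ)) := by
  refine (integrable_re_add_mul_I_cpow hc hδ).bdd_mul (c := 1)
    (Continuous.aestronglyMeasurable (by fun_prop)) (.of_forall fun a => ?_)
  rw [mul_comm, ← Complex.ofReal_mul, Complex.norm_exp_ofReal_mul_I]

/-- The light-cone coordinates `(x, t) ↦ (v t - x, v t + x)`. -/
noncomputable def lightConeMap (v : ℝ) : ℝ × ℝ →ₗ[ℝ] ℝ × ℝ :=
  Matrix.toLin (Module.Basis.finTwoProd ℝ) (Module.Basis.finTwoProd ℝ) !![-1, v; 1, v]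

theorem lightConeMap_apply (v : ℝ) (p : ℝ × ℝ) :
    lightConeMap v p = (v * p.2 - p.1, v * p.2 + p.1) := by
  rw [lightConeMap, Matrix.toLin_finTwoProd_apply]
  ext <;> simp <;> ring

theorem det_lightConeMap (v : ℝ) : LinearMap.det (lightConeMap v) = -(2 * v) := by
  rw [lightConeMap, LinearMap.det_toLin, Matrix.det_fin_two_of]
  ring

theorem measurableEmbedding_lightConeMap {v : ℝ} (hv : 0 < v) :
    MeasurableEmbedding (lightConeMap v) :=
  ((lightConeMap v).equivOfDetNeZero
    (by simp [det_lightConeMap, hv.ne'])).toContinuousLinearEquiv.toHomeomorph.measurableEmbedding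

theorem map_lightConeMap {v : ℝ} (hv : 0 < v) :
    Measure.map (lightConeMap v) volume = ENNReal.ofReal (2 * v)⁻¹ • volume := by
  rw [Measure.map_linearMap_addHaar_eq_smul_addHaar _ (by simp [det_lightConeMap, hv.ne']),
    det_lightConeMap, inv_neg, abs_neg, abs_of_pos (by positivity)]

theorem integrable_comp_lightConeMap {v : ℝ} (hv : 0 < v) {g : ℝ × ℝ → ℂ} (hg : Integrable g) :
    Integrable (g ∘ lightConeMap v) := by
  rw [← (measurableEmbedding_lightConeMap hv).integrable_map_iff, map_lightConeMap hv]
  exact hg.smul_measure ENNReal.ofReal_ne_top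

theorem integral_comp_lightConeMap {v : ℝ} (hv : 0 < v) (g : ℝ × ℝ → ℂ) :
    integral volume (g ∘ lightConeMap v) = (2 * v)⁻¹ • ∫ q, g q := by
  rw [← ENNReal.toReal_ofReal (by positivity : 0 ≤ (2 * v)⁻¹), ← integral_smul_measure,
    ← map_lightConeMap hv, (measurableEmbedding_lightConeMap hv).integral_map]
  rfl

theorem contIntegrand_eq_comp_lightConeMap {vF : ℝ} (hvF : 0 < vF) (ε δp δm k ω : ℝ) :
    (fun p : ℝ × ℝ => contIntegrand vF ε δp δm k ω p.1 p.2) =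
      (fun q : ℝ × ℝ =>
        (Complex.exp (Complex.I * (((ω + vF * k) / (2 * vF) : ℝ) * q.1)) *
          (((vF * ε : ℝ) : ℂ) + Complex.I * q.1) ^ (-(δp : ℂ))) *
        (Complex.exp (Complex.I * (((ω - vF * k) / (2 * vF) : ℝ) * q.2)) *
          (((vF * ε : ℝ) : ℂ) + Complex.I * q.2) ^ (-(δm : ℂ)))) ∘ lightConeMap vF := by
  funext p
  have hv : (vF : ℂ) ≠ 0 := Complex.ofReal_ne_zero.mpr hvF.ne'
  simp only [Function.comp_apply, lightConeMap_apply, contIntegrand]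
  rw [mul_mul_mul_comm, ← Complex.exp_add, mul_assoc]
  push_cast
  congr 2
  · field_simp
    ring
  · congr 1
    linear_combination (-(vF : ℂ) * ε) * Complex.I_sq
  · congr 1
    linear_combination (-(vF : ℂ) * ε) * Complex.I_sq

/-- Continuous factorized evaluation: for `v_F, ε > 0`, `δ₊, δ₋ > 1`, and
`Ω_± = (ω ± v_F k)/(2 v_F)`, the double integral `∫∫ e^{i(ωt−kx)} ∏ (i[v_F(t−iε)−υx])^{−δ_υ} dt dx`
converges absolutely and equals
`((2π)² e^{−εω})/(2 v_F Γ(δ₊)Γ(δ₋)) Ω₊^{δ₊−1} Ω₋^{δ₋−1}` if `Ω₊, Ω₋ > 0` and `0` otherwise. -/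
theorem continuous_fourier_evaluation (vF ε δp δm k ω : ℝ)
    (hvF : 0 < vF) (hε : 0 < ε) (hδp : 1 < δp) (hδm : 1 < δm) :
    Integrable (fun p : ℝ × ℝ => contIntegrand vF ε δp δm k ω p.1 p.2) ∧
    (∫ p : ℝ × ℝ, contIntegrand vF ε δp δm k ω p.1 p.2) =
      if 0 < (ω + vF * k) / (2 * vF) ∧ 0 < (ω - vF * k) / (2 * vF) then
        (((2 * π) ^ 2 * Real.exp (-(ε * ω)) / (2 * vF * Real.Gamma δp * Real.Gamma δm) *
          (((ω + vF * k) / (2 * vF)) ^ (δp - 1) * ((ω - vF * k) / (2 * vF)) ^ (δm - 1)) : ℝ) : ℂ)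
      else 0 := by
  have hc : 0 < vF * ε := mul_pos hvF hε
  rw [contIntegrand_eq_comp_lightConeMap hvF]
  constructor
  · exact integrable_comp_lightConeMap hvF
      ((integrable_exp_mul_re_add_mul_I_cpow hc hδp _).mul_prod
        (integrable_exp_mul_re_add_mul_I_cpow hc hδm _))
  · rw [integral_comp_lightConeMap hvF, Measure.volume_eq_prod,
      integral_prod_mul (fun a : ℝ =>
        Complex.exp (Complex.I * (((ω + vF * k) / (2 * vF) : ℝ) * a)) *
          (((vF * ε : ℝ) : ℂ) + Complex.I * a) ^ (-(δp : ℂ))) (fun b : ℝ =>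
        Complex.exp (Complex.I * (((ω - vF * k) / (2 * vF) : ℝ) * b)) *
          (((vF * ε : ℝ) : ℂ) + Complex.I * b) ^ (-(δm : ℂ))),
      integral_exp_mul_re_add_mul_I_cpow hc hδp, integral_exp_mul_re_add_mul_I_cpow hc hδm,
      Complex.real_smul]
    split_ifs with h
    · have hexp : Real.exp (-(ε * ω)) =
          Real.exp (-(vF * ε * ((ω + vF * k) / (2 * vF)))) *
            Real.exp (-(vF * ε * ((ω - vF * k) / (2 * vF)))) := by
        rw [← Real.exp_add]
        congr 1
        field_simp
        ring
      rw [gammaKernel, gammaKernel, max_eq_left h.1.le, max_eq_left h.2.le, hexp,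
        Complex.Gamma_ofReal, Complex.Gamma_ofReal]
      norm_cast
      have h1 := (Real.Gamma_pos_of_pos (by linarith : 0 < δp)).ne'
      have h2 := (Real.Gamma_pos_of_pos (by linarith : 0 < δm)).ne'
      field_simp
    · rcases not_and_or.mp h with h | h <;>
        simp [gammaKernel_of_nonpos _ (not_lt.mp h), *]
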